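/- With the notation of the construction over 3 = {0,1,2} (T, ↩, E as defined), the language A := {0} ∪ E ∪ { c_0 1 c_1 1 ⋯ c_k 1 : k ∈ ω, each c_j a finite concatenation of words from {0} ∪ E, and (k > 0 or c_0 ≠ ∅) } is a context-free language; moreover the ω-power A^ω is an F_σ subset of 3^ω (a countable union of closed sets) that is not G_δ (not a countable intersection of open sets). -/

import Mathlib

open Set

/-- The ω-power of a finitary language `V ⊆ α^{<ω}`. -/
def omegaPower {α : Type*} (V : Set (List α)) : Set (ℕ → α) :=
  { x | ∃ f : ℕ → ℕ, f 0 = 0 ∧ StrictMono f ∧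
      ∀ k, (List.ofFn fun i : Fin (f (k + 1) - f k) => x (f k + i.val)) ∈ V }

/-- The prefix of length `l` of an infinite word. -/
def wordPrefix {α : Type*} (x : ℕ → α) (l : ℕ) : List α := List.ofFn fun i : Fin l => x i.val

/-- `T ∩ 3^{<ω}`: finite words over `3 = {0,1,2}` all of whose prefixes contain at most as
many `2`s as `1`s. -/
def Tfin : Set (List (Fin 3)) :=
  { s | ∀ l : ℕ, (s.take l).count 2 ≤ (s.take l).count 1 }

/-- `T ∩ 3^ω`: infinite words over `3 = {0,1,2}` all of whose finite prefixes contain at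
most as many `2`s as `1`s. -/
def Tinf : Set (ℕ → Fin 3) :=
  { α | ∀ l : ℕ, (wordPrefix α l).count 2 ≤ (wordPrefix α l).count 1 }

/-- Replace the first occurrence of `1` (i.e. `true`) in a binary word by `0`. -/
def replaceFirstOne : List Bool → List Bool
  | [] => []
  | true :: t => false :: t
  | false :: t => false :: replaceFirstOne t

/-- Replace the last occurrence of `1` (i.e. `true`) in a binary word by `0`. -/
def replaceLastOne (l : List Bool) : List Bool := (replaceFirstOne l.reverse).reverse

/-- One step of the erasing operation: appending a letter `ε ∈ {0,1}` appends it to the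
erased word, while appending the letter `2` replaces the last `1` of the erased word by `0`. -/
def eraseStep (acc : List Bool) (a : Fin 3) : List Bool :=
  if a = 2 then replaceLastOne acc else acc ++ [decide (a = 1)]

/-- The erasing operation `s ↦ s^↩` on finite words over `3 = {0,1,2}` (letters `0`,`1` of
the binary output are encoded as `false`,`true`): `∅^↩ = ∅`, `(tε)^↩ = t^↩ε` for `ε ∈ {0,1}`,
and `(t2)^↩ = t^↩` with its last `1` replaced by `0`. -/
def eraseWord (s : List (Fin 3)) : List Bool := s.foldl eraseStep []

/-- The language `E`: nonempty words `s ∈ T` with equally many `1`s and `2`s such that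
the erasure of `s` minus its last letter begins with the letter `1`. -/
def Elang : Set (List (Fin 3)) :=
  { s | s ∈ Tfin ∧ s ≠ [] ∧ s.count 1 = s.count 2 ∧
      (eraseWord (s.take (s.length - 1))).head? = some true }

/-- Finite concatenations of words from `S` (the Kleene star `S*`). -/
def starSet {α : Type*} (S : Set (List α)) : Set (List α) :=
  { s | ∃ L : List (List α), (∀ u ∈ L, u ∈ S) ∧ s = L.flatten }

/-- The language `A := {0} ∪ E ∪ { c_0 1 c_1 1 ⋯ c_k 1 : each c_j ∈ ({0} ∪ E)*, and
k > 0 or c_0 ≠ ∅ }`. -/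
def Alang : Set (List (Fin 3)) :=
  {[(0 : Fin 3)]} ∪ Elang ∪
    { s | ∃ (k : ℕ) (c : ℕ → List (Fin 3)),
        (∀ j ≤ k, c j ∈ starSet ({[(0 : Fin 3)]} ∪ Elang)) ∧
        (0 < k ∨ c 0 ≠ []) ∧
        s = (List.ofFn fun j : Fin (k + 1) => c j.val ++ [(1 : Fin 3)]).flatten }

/-- A set is `F_σ` if it is a countable union of closed sets. -/
def FSigmaSet {X : Type*} [TopologicalSpace X] (s : Set X) : Prop :=
  ∃ F : ℕ → Set X, (∀ n, IsClosed (F n)) ∧ s = ⋃ n, F n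

/-- A set is `G_δ` if it is a countable intersection of open sets. -/
def GDeltaSet {X : Type*} [TopologicalSpace X] (s : Set X) : Prop :=
  ∃ U : ℕ → Set X, (∀ n, IsOpen (U n)) ∧ s = ⋂ n, U n


namespace AL

/-- Heights stay nonnegative when starting from `k`. -/
def ok : ℕ → List (Fin 3) → Prop
  | _, [] => True
  | k, a :: w => if a = 2 then (0 < k ∧ ok (k - 1) w) else if a = 1 then ok (k + 1) w else ok k w

inductive D : List (Fin 3) → Prop
  | nil : D []
  | zero {w} : D w → D (0 :: w)
  | br {u v} : D u → D v → D (1 :: (u ++ 2 :: v))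

inductive R : List (Fin 3) → Prop
  | one : R [1]
  | up {w} : R w → R (1 :: w)
  | zero {w} : R w → R (0 :: w)
  | br {u v} : D u → R v → R (1 :: (u ++ 2 :: v))

lemma ok_iff (w : List (Fin 3)) : ∀ k, ok k w ↔ ∀ l, (w.take l).count 2 ≤ k + (w.take l).count 1 := by
  induction w with
  | nil => intro k; simp [ok]
  | cons a w ih =>
    intro k
    have key : (∀ l, ((a :: w).take l).count 2 ≤ k + ((a :: w).take l).count 1) ↔
        ∀ l, (a :: w.take l).count 2 ≤ k + (a :: w.take l).count 1 := by
      constructor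
      · intro h l; simpa using h (l + 1)
      · intro h l
        cases l with
        | zero => simp
        | succ l => simpa using h l
    rw [key]
    fin_cases a
    · simp [ok, ih]
    · simp [ok, ih, add_assoc, add_comm]
    · simp only [ok, ih]
      simp
      constructor
      · rintro ⟨h, h2⟩ l
        have := h2 l
        omega
      · intro h
        have := h 0
        simp at this
        refine ⟨by omega, fun l => ?_⟩
        have := h l
        omega

lemma Tfin_iff (w : List (Fin 3)) : w ∈ Tfin ↔ ok 0 w := by
  rw [ok_iff]; simp [Tfin]

lemma D.append {u v : List (Fin 3)} (hu : D u) (hv : D v) : D (u ++ v) := by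
  induction hu with
  | nil => simpa
  | zero _ ih => exact D.zero ih
  | br h1 h2 ih1 ih2 => simpa using D.br h1 ih2

lemma D.appendR {u v : List (Fin 3)} (hu : D u) (hv : R v) : R (u ++ v) := by
  induction hu with
  | nil => simpa
  | zero _ ih => exact R.zero ih
  | br h1 h2 ih1 ih2 => simpa using R.br h1 ih2

lemma D.ok_append {u : List (Fin 3)} (hu : D u) : ∀ k v, ok k (u ++ v) ↔ ok k v := by
  induction hu with
  | nil => simp
  | zero _ ih => intro k v; simp [ok, ih]
  | br h1 h2 ih1 ih2 => intro k v; simp [ok, ih1, ih2]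

lemma D.count {u : List (Fin 3)} (hu : D u) : u.count 1 = u.count 2 := by
  induction hu with
  | nil => simp
  | zero _ ih => simpa using ih
  | br h1 h2 ih1 ih2 => simp; omega

lemma D.ok {u : List (Fin 3)} (hu : D u) (k) : ok k u := by
  have := (hu.ok_append k []).2 trivial
  simpa using this

def Dk : ℕ → List (Fin 3) → Prop
  | 0, w => D w
  | k + 1, w => ∃ u v, w = u ++ 2 :: v ∧ D u ∧ Dk k v

lemma Dk.append {k u w} (hu : D u) (hw : Dk k w) : Dk k (u ++ w) := by
  cases k with
  | zero => exact D.append hu hw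
  | succ k =>
    obtain ⟨a, b, rfl, ha, hb⟩ := hw
    exact ⟨u ++ a, b, by simp, hu.append ha, hb⟩

lemma Dk_of_ok (w : List (Fin 3)) : ∀ k, ok k w → w.count 1 + k = w.count 2 → Dk k w := by
  induction w with
  | nil => intro k _ h; simp at h; subst h; exact D.nil
  | cons a w ih =>
    intro k h1 h2
    fin_cases a
    · simp [ok] at h1 h2
      exact Dk.append (u := [0]) (D.zero D.nil) (ih k h1 h2)
    · simp [ok] at h1 h2
      obtain ⟨u, v, rfl, hu, hv⟩ := ih (k + 1) h1 (by omega)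
      have := Dk.append (D.br hu D.nil) hv
      simpa using this
    · simp [ok] at h1 h2
      obtain ⟨k, rfl⟩ : ∃ j, k = j + 1 := ⟨k - 1, by omega⟩
      exact ⟨[], w, rfl, D.nil, ih k (by simpa using h1.2) (by omega)⟩

lemma D_iff (w : List (Fin 3)) : D w ↔ ok 0 w ∧ w.count 1 = w.count 2 :=
  ⟨fun h => ⟨h.ok 0, h.count⟩, fun h => Dk_of_ok w 0 h.1 (by simpa using h.2)⟩

def Rk : ℕ → List (Fin 3) → Prop
  | 0, w => R w
  | k + 1, w => R w ∨ ∃ u v, w = u ++ 2 :: v ∧ D u ∧ Rk k v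

lemma R.Rk {w} (h : R w) (k) : Rk k w := by
  cases k with
  | zero => exact h
  | succ k => exact Or.inl h

lemma Rk.append {k u w} (hu : D u) (hw : Rk k w) : Rk k (u ++ w) := by
  cases k with
  | zero => exact D.appendR hu hw
  | succ k =>
    rcases hw with hw | ⟨a, b, rfl, ha, hb⟩
    · exact Or.inl (hu.appendR hw)
    · exact Or.inr ⟨u ++ a, b, by simp, hu.append ha, hb⟩

lemma Rk_of_ok (w : List (Fin 3)) : ∀ k, ok k (w ++ [1]) → Rk k (w ++ [1]) := by
  induction w with
  | nil => intro k _; exact R.one.Rk k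
  | cons a w ih =>
    intro k h1
    fin_cases a
    · simp [ok] at h1
      exact Rk.append (u := [0]) (D.zero D.nil) (ih k h1)
    · simp [ok] at h1
      rcases ih (k + 1) h1 with h | ⟨u, v, e, hu, hv⟩
      · exact (R.up h).Rk k
      · have := Rk.append (D.br hu D.nil) hv
        simpa [e] using this
    · simp [ok] at h1
      obtain ⟨k, rfl⟩ : ∃ j, k = j + 1 := ⟨k - 1, by omega⟩
      exact Or.inr ⟨[], w ++ [1], rfl, D.nil, ih k (by simpa using h1.2)⟩

lemma R.ok {w} (h : R w) : ∀ k, ok k w := by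
  induction h with
  | one => intro k; simp [AL.ok]
  | up _ ih => intro k; simp [AL.ok, ih]
  | zero _ ih => intro k; simp [AL.ok, ih]
  | br h1 _ ih => intro k; simp [AL.ok, h1.ok_append, ih]

lemma R.last {w} (h : R w) : ∃ t, w = t ++ [1] := by
  induction h with
  | one => exact ⟨[], rfl⟩
  | up _ ih => obtain ⟨t, rfl⟩ := ih; exact ⟨1 :: t, rfl⟩
  | zero _ ih => obtain ⟨t, rfl⟩ := ih; exact ⟨0 :: t, rfl⟩
  | @br u v h1 _ ih => obtain ⟨t, rfl⟩ := ih; exact ⟨1 :: (u ++ 2 :: t), by simp⟩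

lemma R_iff (w : List (Fin 3)) : R w ↔ ok 0 w ∧ ∃ t, w = t ++ [1] := by
  constructor
  · exact fun h => ⟨h.ok 0, h.last⟩
  · rintro ⟨h, t, rfl⟩
    exact Rk_of_ok t 0 h

/-! erasure -/

lemma rfo_append_true (l : List Bool) (h : true ∈ l) (m) :
    replaceFirstOne (l ++ m) = replaceFirstOne l ++ m := by
  induction l with
  | nil => simp at h
  | cons a l ih =>
    cases a
    · simp at h; simp [replaceFirstOne, ih h]
    · simp [replaceFirstOne]

lemma rfo_append_false (l : List Bool) (h : true ∉ l) (m) :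
    replaceFirstOne (l ++ m) = l ++ replaceFirstOne m := by
  induction l with
  | nil => simp
  | cons a l ih =>
    cases a
    · simp at h; simp [replaceFirstOne, ih h]
    · simp at h

lemma rlo_true (acc : List Bool) (h : true ∈ acc) :
    replaceLastOne (true :: acc) = true :: replaceLastOne acc := by
  simp [replaceLastOne, rfo_append_true _ (List.mem_reverse.2 h)]

lemma rlo_true' (acc : List Bool) (h : true ∉ acc) :
    replaceLastOne (true :: acc) = false :: acc := by
  rw [replaceLastOne, List.reverse_cons, rfo_append_false _ (by simpa using h)]
  simp [replaceFirstOne]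

lemma rlo_false (acc : List Bool) :
    replaceLastOne (false :: acc) = false :: replaceLastOne acc := by
  by_cases h : true ∈ acc
  · simp [replaceLastOne, rfo_append_true _ (List.mem_reverse.2 h)]
  · rw [replaceLastOne, List.reverse_cons, rfo_append_false _ (by simpa using h)]
    have := rfo_append_false acc.reverse (by simpa using h) []
    simp [replaceFirstOne] at this
    simp [replaceFirstOne, replaceLastOne, this]

lemma rfo_count (l : List Bool) : (replaceFirstOne l).count true = l.count true - 1 := by
  induction l with
  | nil => simp [replaceFirstOne]
  | cons a l ih => cases a <;> simp [replaceFirstOne, ih]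

lemma rlo_count (l : List Bool) : (replaceLastOne l).count true = l.count true - 1 := by
  simp [replaceLastOne, rfo_count]

lemma foldl_false (w : List (Fin 3)) : ∀ acc,
    (w.foldl eraseStep (false :: acc)).head? = some false := by
  induction w with
  | nil => simp
  | cons a w ih =>
    intro acc
    by_cases h : a = 2
    · simp [eraseStep, h, rlo_false, ih]
    · simp [eraseStep, h, ih]

lemma foldl_true (w : List (Fin 3)) : ∀ acc,
    (w.foldl eraseStep (true :: acc)).head? = some true ↔ ok (acc.count true) w := by
  induction w with
  | nil => simp [ok]
  | cons a w ih =>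
    intro acc
    fin_cases a
    · simp [eraseStep, ok, ih]
    · simp [eraseStep, ok, ih]
    · by_cases h : true ∈ acc
      · simp [eraseStep, ok, rlo_true _ h, ih, rlo_count, h]
      · simp [eraseStep, ok, rlo_true' _ h, foldl_false, h]

lemma E_iff (s : List (Fin 3)) : s ∈ Elang ↔ ∃ u, D u ∧ s = 1 :: (u ++ [2]) := by
  constructor
  · rintro ⟨hT, hne, hc, hh⟩
    rw [Tfin_iff] at hT
    obtain ⟨a, s, rfl⟩ := List.exists_cons_of_ne_nil hne
    rcases List.eq_nil_or_concat s with rfl | ⟨w, b, rfl⟩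
    · simp [eraseWord] at hh
    · simp [eraseWord] at hh
      fin_cases a
      · simp [eraseStep, foldl_false] at hh
      · simp [eraseStep, foldl_true] at hh
        simp at hc
        have h2 := (ok_iff w 0).1 hh w.length
        simp at h2
        refine ⟨w, (D_iff w).2 ⟨hh, ?_⟩, ?_⟩
        · fin_cases b <;> simp at hc <;> omega
        · fin_cases b <;> simp at hc ⊢ <;> omega
      · simp [ok] at hT
  · rintro ⟨u, hu, rfl⟩
    refine ⟨?_, by simp, ?_, ?_⟩
    · rw [Tfin_iff]
      simp [ok, hu.ok_append]
    · simp [hu.count]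
    · simp [eraseWord]
      simp [eraseStep, foldl_true, hu.ok]

lemma star_iff (s : List (Fin 3)) : s ∈ starSet ({[(0 : Fin 3)]} ∪ Elang) ↔ D s := by
  constructor
  · rintro ⟨L, hL, rfl⟩
    induction L with
    | nil => exact D.nil
    | cons a L ih =>
      simp only [List.flatten_cons]
      refine D.append ?_ (ih fun u hu => hL u (by simp [hu]))
      rcases hL a (by simp) with h | h
      · rw [Set.mem_singleton_iff.1 h]; exact D.zero D.nil
      · obtain ⟨u, hu, rfl⟩ := (E_iff a).1 h
        exact D.br hu D.nil
  · intro h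
    induction h with
    | nil => exact ⟨[], by simp, rfl⟩
    | @zero w _ ih =>
      obtain ⟨L, hL, rfl⟩ := ih
      refine ⟨[0] :: L, ?_, by simp⟩
      intro u hu
      rcases List.mem_cons.1 hu with rfl | hu
      · left; rfl
      · exact hL u hu
    | @br u v h1 h2 ih1 ih2 =>
      obtain ⟨L, hL, rfl⟩ := ih2
      refine ⟨(1 :: (u ++ [2])) :: L, ?_, by simp⟩
      intro t ht
      rcases List.mem_cons.1 ht with rfl | ht
      · right; exact (E_iff _).2 ⟨u, h1, rfl⟩
      · exact hL t ht

lemma R_exists {s} (h : R s) : ∃ (c : List (Fin 3)) (L : List (List (Fin 3))),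
    (∀ u ∈ c :: L, D u) ∧ s = ((c :: L).map (· ++ [(1 : Fin 3)])).flatten := by
  induction h with
  | one => exact ⟨[], [], by simp [D.nil], rfl⟩
  | up _ ih =>
    obtain ⟨c, L, h, rfl⟩ := ih
    refine ⟨[], c :: L, ?_, by simp⟩
    intro u hu
    rcases List.mem_cons.1 hu with rfl | hu
    · exact D.nil
    · exact h u hu
  | zero _ ih =>
    obtain ⟨c, L, h, rfl⟩ := ih
    refine ⟨0 :: c, L, ?_, by simp⟩
    intro u hu
    rcases List.mem_cons.1 hu with rfl | hu
    · exact D.zero (h c (by simp))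
    · exact h u (by simp [hu])
  | @br a _ ha _ ih =>
    obtain ⟨c, L, h, rfl⟩ := ih
    refine ⟨1 :: (a ++ 2 :: c), L, ?_, by simp⟩
    intro u hu
    rcases List.mem_cons.1 hu with rfl | hu
    · exact D.br ha (h c (by simp))
    · exact h u (by simp [hu])

lemma R_of_list (L : List (List (Fin 3))) : ∀ c, D c → (∀ u ∈ L, D u) →
    R (((c :: L).map (· ++ [(1 : Fin 3)])).flatten) := by
  induction L with
  | nil => intro c hc _; simpa using hc.appendR R.one
  | cons a L ih =>
    intro c hc h
    have := ih a (h a (by simp)) (fun u hu => h u (by simp [hu]))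
    have := hc.appendR (R.up this)
    simpa using this

lemma third_iff (s : List (Fin 3)) : (∃ (k : ℕ) (c : ℕ → List (Fin 3)),
        (∀ j ≤ k, c j ∈ starSet ({[(0 : Fin 3)]} ∪ Elang)) ∧
        (0 < k ∨ c 0 ≠ []) ∧
        s = (List.ofFn fun j : Fin (k + 1) => c j.val ++ [(1 : Fin 3)]).flatten) ↔
      R s ∧ s ≠ [1] := by
  simp only [star_iff]
  constructor
  · rintro ⟨k, c, hc, hk, rfl⟩
    constructor
    · have := R_of_list (List.ofFn fun j : Fin k => c (j.val + 1)) (c 0) (hc 0 (by simp)) (by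
        intro u hu
        obtain ⟨j, rfl⟩ := List.mem_ofFn.1 hu
        exact hc _ (by omega))
      rw [List.ofFn_succ]
      simpa [List.map_ofFn, Function.comp_def] using this
    · intro h
      have := congrArg List.length h
      rw [List.ofFn_succ] at this
      simp at this
      rcases hk with hk | hk
      · obtain ⟨k, rfl⟩ : ∃ j, k = j + 1 := ⟨k - 1, by omega⟩
        rw [List.ofFn_succ] at this
        simp at this
        omega
      · exact hk (by apply List.eq_nil_of_length_eq_zero; omega)
  · rintro ⟨h, hne⟩
    obtain ⟨c, L, hD, rfl⟩ := R_exists h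
    refine ⟨L.length, fun j => (c :: L).getD j [], ?_, ?_, ?_⟩
    · intro j hj
      have hj' : j < (c :: L).length := by simp; omega
      simp only [List.getD_eq_getElem _ _ hj']
      exact hD _ (List.getElem_mem _)
    · by_contra hcon
      push Not at hcon
      obtain ⟨h1, h2⟩ := hcon
      simp at h2
      have : L = [] := List.eq_nil_of_length_eq_zero (by omega)
      subst this; subst h2
      simp at hne
    · congr 1
      apply List.ext_getElem
      · simp
      · intro n h1 h2
        simp at h1
        simp only [List.getElem_map, List.getElem_ofFn]
        rw [List.getD_eq_getElem]

lemma A_iff (s : List (Fin 3)) : s ∈ Alang ↔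
    s = [0] ∨ (∃ u, D u ∧ s = 1 :: (u ++ [2])) ∨ (R s ∧ s ≠ [1]) := by
  rw [← E_iff, ← third_iff]
  simp only [Alang, Set.mem_union, Set.mem_singleton_iff, Set.mem_ofPred_eq, or_assoc]

/-! context-free -/

section cf

inductive NT | S | D | R

open Symbol NT

abbrev t (a : Fin 3) : Symbol (Fin 3) NT := terminal a
abbrev n (a : NT) : Symbol (Fin 3) NT := nonterminal a

def ruleList : List (ContextFreeRule (Fin 3) NT) :=
  [⟨S, [t 0]⟩, ⟨S, [t 1, n NT.D, t 2]⟩, ⟨S, [t 0, n NT.R]⟩, ⟨S, [t 1, n NT.R]⟩,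
   ⟨S, [t 1, n NT.D, t 2, n NT.R]⟩,
   ⟨NT.D, []⟩, ⟨NT.D, [t 0, n NT.D]⟩, ⟨NT.D, [t 1, n NT.D, t 2, n NT.D]⟩,
   ⟨NT.R, [t 1]⟩, ⟨NT.R, [t 1, n NT.R]⟩, ⟨NT.R, [t 0, n NT.R]⟩,
   ⟨NT.R, [t 1, n NT.D, t 2, n NT.R]⟩]

open Classical in
noncomputable abbrev G : ContextFreeGrammar (Fin 3) := ⟨NT, S, ruleList.toFinset⟩

def semNT : NT → Set (List (Fin 3))
  | NT.S => Alang
  | NT.D => {w | AL.D w}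
  | NT.R => {w | AL.R w}

/-- semantics of sentential forms -/
def sem : List (Symbol (Fin 3) NT) → List (Fin 3) → Prop
  | [], w => w = []
  | terminal a :: l, w => ∃ v, w = a :: v ∧ sem l v
  | nonterminal N :: l, w => ∃ u v, w = u ++ v ∧ u ∈ semNT N ∧ sem l v

lemma sem_append (p q : List (Symbol (Fin 3) NT)) : ∀ w, sem (p ++ q) w ↔
    ∃ u v, w = u ++ v ∧ sem p u ∧ sem q v := by
  induction p with
  | nil => intro w; simp [sem]
  | cons a p ih =>
    intro w
    cases a with
    | terminal a =>
      simp only [List.cons_append, sem, ih]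
      constructor
      · rintro ⟨_, rfl, u, v, rfl, h1, h2⟩
        exact ⟨a :: u, v, rfl, ⟨u, rfl, h1⟩, h2⟩
      · rintro ⟨_, v, rfl, ⟨u, rfl, h1⟩, h2⟩
        exact ⟨u ++ v, rfl, u, v, rfl, h1, h2⟩
    | nonterminal N =>
      simp only [List.cons_append, sem, ih]
      constructor
      · rintro ⟨x, _, rfl, hx, u, v, rfl, h1, h2⟩
        exact ⟨x ++ u, v, by simp, ⟨x, u, rfl, hx, h1⟩, h2⟩
      · rintro ⟨_, v, rfl, ⟨x, u, rfl, hx, h1⟩, h2⟩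
        exact ⟨x, u ++ v, by simp, hx, u, v, rfl, h1, h2⟩

lemma sem_rule (r) (hr : r ∈ ruleList) (w) (h : sem r.output w) : w ∈ semNT r.input := by
  simp only [ruleList, List.mem_cons, List.not_mem_nil, or_false] at hr
  rcases hr with rfl | rfl | rfl | rfl | rfl | rfl | rfl | rfl | rfl | rfl | rfl | rfl <;>
    simp only [sem, semNT, Set.mem_ofPred_eq, A_iff] at h ⊢
  · obtain ⟨v, rfl, rfl⟩ := h; simp
  · obtain ⟨_, rfl, u, _, rfl, hu, _, rfl, rfl⟩ := h
    exact Or.inr (Or.inl ⟨u, hu, rfl⟩)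
  · obtain ⟨_, rfl, u, _, rfl, hu, rfl⟩ := h
    simp
    exact Or.inr (R.zero hu)
  · obtain ⟨_, rfl, u, _, rfl, hu, rfl⟩ := h
    right; right
    obtain ⟨t, rfl⟩ := hu.last
    exact ⟨by simpa using R.up hu, by simp⟩
  · obtain ⟨_, rfl, u, _, rfl, hu, _, rfl, v, _, rfl, hv, rfl⟩ := h
    right; right
    exact ⟨by simpa using R.br hu hv, by simp⟩
  · subst h; exact D.nil
  · obtain ⟨_, rfl, u, _, rfl, hu, rfl⟩ := h
    simpa using D.zero hu
  · obtain ⟨_, rfl, u, _, rfl, hu, _, rfl, v, _, rfl, hv, rfl⟩ := h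
    simpa using D.br hu hv
  · obtain ⟨v, rfl, rfl⟩ := h; exact R.one
  · obtain ⟨_, rfl, u, _, rfl, hu, rfl⟩ := h
    simpa using R.up hu
  · obtain ⟨_, rfl, u, _, rfl, hu, rfl⟩ := h
    simpa using R.zero hu
  · obtain ⟨_, rfl, u, _, rfl, hu, _, rfl, v, _, rfl, hv, rfl⟩ := h
    simpa using R.br hu hv

lemma sem_produces {u v : List (Symbol (Fin 3) NT)} (h : G.Produces u v) (w) (hv : sem v w) :
    sem u w := by
  obtain ⟨r, hr, h⟩ := h
  obtain ⟨p, q, rfl, rfl⟩ := h.exists_parts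
  have hr' : r ∈ ruleList := by classical exact List.mem_toFinset.1 hr
  rw [List.append_assoc, sem_append] at hv ⊢
  obtain ⟨a, b, rfl, ha, hb⟩ := hv
  rw [sem_append] at hb
  obtain ⟨b, c, rfl, hb, hc⟩ := hb
  refine ⟨a, b ++ c, rfl, ha, ?_⟩
  exact ⟨b, c, rfl, sem_rule r hr' b hb, hc⟩

lemma sem_derives {u v : List (Symbol (Fin 3) NT)} (h : G.Derives u v) (w) (hv : sem v w) :
    sem u w := by
  induction h with
  | refl => exact hv
  | tail _ h ih => exact ih (sem_produces h w hv)

lemma sem_terminal (w : List (Fin 3)) : sem (w.map terminal) w := by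
  induction w with
  | nil => rfl
  | cons a w ih => exact ⟨w, rfl, ih⟩

open Classical in
lemma der_rule (r) (hr : r ∈ ruleList) : G.Derives [nonterminal r.input] r.output :=
  ContextFreeGrammar.Produces.single ⟨r, List.mem_toFinset.2 hr, ContextFreeRule.Rewrites.input_output⟩

lemma der_append {a b c d : List (Symbol (Fin 3) G.NT)} (h : G.Derives a b) (h' : G.Derives c d) :
    G.Derives (a ++ c) (b ++ d) :=
  (h.append_right c).trans (h'.append_left b)

lemma der_cons {c d : List (Symbol (Fin 3) G.NT)} (a) (h' : G.Derives c d) :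
    G.Derives (a :: c) (a :: d) := h'.append_left [a]

lemma der_D {w} (h : D w) : G.Derives [n NT.D] (w.map terminal) := by
  induction h with
  | nil => exact der_rule ⟨NT.D, []⟩ (by simp [ruleList])
  | zero _ ih =>
    exact (der_rule ⟨NT.D, [t 0, n NT.D]⟩ (by simp [ruleList])).trans (der_cons _ ih)
  | br _ _ ih1 ih2 =>
    refine (der_rule ⟨NT.D, [t 1, n NT.D, t 2, n NT.D]⟩ (by simp [ruleList])).trans ?_
    have := der_cons (t 1) (der_append ih1 (der_cons (t 2) ih2))
    simp only [List.map_cons, List.map_append]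
    exact this

lemma der_R {w} (h : R w) : G.Derives [n NT.R] (w.map terminal) := by
  induction h with
  | one => exact der_rule ⟨NT.R, [t 1]⟩ (by simp [ruleList])
  | zero _ ih =>
    exact (der_rule ⟨NT.R, [t 0, n NT.R]⟩ (by simp [ruleList])).trans (der_cons _ ih)
  | up _ ih =>
    exact (der_rule ⟨NT.R, [t 1, n NT.R]⟩ (by simp [ruleList])).trans (der_cons _ ih)
  | br h _ ih2 =>
    refine (der_rule ⟨NT.R, [t 1, n NT.D, t 2, n NT.R]⟩ (by simp [ruleList])).trans ?_
    have := der_cons (t 1) (der_append (der_D h) (der_cons (t 2) ih2))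
    simp only [List.map_cons, List.map_append]
    exact this

lemma der_A {w} (h : w ∈ Alang) : G.Derives [n NT.S] (w.map terminal) := by
  rw [A_iff] at h
  rcases h with rfl | ⟨u, hu, rfl⟩ | ⟨h, hne⟩
  · exact der_rule ⟨NT.S, [t 0]⟩ (by simp [ruleList])
  · refine (der_rule ⟨NT.S, [t 1, n NT.D, t 2]⟩ (by simp [ruleList])).trans ?_
    have := der_cons (t 1) ((der_D hu).append_right [t 2])
    simp only [List.map_cons, List.map_append, List.map_nil]
    exact this
  · cases h with
    | one => exact absurd rfl hne
    | zero h =>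
      exact (der_rule ⟨NT.S, [t 0, n NT.R]⟩ (by simp [ruleList])).trans (der_cons _ (der_R h))
    | up h =>
      exact (der_rule ⟨NT.S, [t 1, n NT.R]⟩ (by simp [ruleList])).trans (der_cons _ (der_R h))
    | br h h2 =>
      refine (der_rule ⟨NT.S, [t 1, n NT.D, t 2, n NT.R]⟩ (by simp [ruleList])).trans ?_
      have := der_cons (t 1) (der_append (der_D h) (der_cons (t 2) (der_R h2)))
      simp only [List.map_cons, List.map_append]
      exact this

theorem contextFree : Language.IsContextFree (Alang : Language (Fin 3)) := by
  refine ⟨G, ?_⟩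
  ext w
  rw [ContextFreeGrammar.mem_language_iff]
  constructor
  · intro h
    have := sem_derives h w (sem_terminal w)
    obtain ⟨u, v, rfl, hu, hv⟩ := this
    cases hv
    rw [List.append_nil]
    exact hu
  · exact fun h => der_A h

end cf

/-! the omega-power -/

def wt (a : Fin 3) : ℤ := if a = 1 then 1 else if a = 2 then -1 else 0

def H (x : ℕ → Fin 3) : ℕ → ℤ
  | 0 => 0
  | n + 1 => H x n + wt (x n)

def seg (x : ℕ → Fin 3) (m n : ℕ) : List (Fin 3) := List.ofFn fun i : Fin n => x (m + i.val)

lemma seg_succ (x m n) : seg x m (n + 1) = seg x m n ++ [x (m + n)] := by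
  rw [seg, List.ofFn_succ_last]; rfl

lemma seg_take (x : ℕ → Fin 3) (m n l : ℕ) (h : l ≤ n) : (seg x m n).take l = seg x m l := by
  apply List.ext_getElem
  · simp [seg, h]
  · intro i h1 h2
    simp [seg]

lemma seg_length (x m n) : (seg x m n).length = n := by simp [seg]

lemma seg_count (x m n) :
    ((seg x m n).count 1 : ℤ) - (seg x m n).count 2 = H x (m + n) - H x m := by
  induction n with
  | zero => simp [seg]
  | succ n ih =>
    rw [seg_succ, ← add_assoc, H]
    simp only [List.count_append, Nat.cast_add]
    have : (([x (m + n)] : List (Fin 3)).count 1 : ℤ) - ([x (m + n)] : List (Fin 3)).count 2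
        = wt (x (m + n)) := by
      generalize x (m + n) = a
      fin_cases a <;> simp [wt]
    linarith

lemma seg_ok (x m n) : ok 0 (seg x m n) ↔ ∀ l ≤ n, H x m ≤ H x (m + l) := by
  rw [ok_iff]
  constructor
  · intro h l hl
    have := h l
    rw [seg_take _ _ _ _ hl] at this
    have := seg_count x m l
    omega
  · intro h l
    rcases le_total l n with hl | hl
    · rw [seg_take _ _ _ _ hl]
      have := seg_count x m l
      have := h l hl
      omega
    · rw [List.take_of_length_le (by rwa [seg_length])]
      have := seg_count x m n
      have := h n le_rfl
      omega

lemma wt_le (a) : wt a ≤ 1 := by fin_cases a <;> simp [wt]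

lemma wt_one {a} (h : 1 ≤ wt a) : a = 1 := by fin_cases a <;> simp [wt] at h ⊢

/-- `m` is a cut position -/
def safe (x : ℕ → Fin 3) (m : ℕ) : Prop := ∀ n ≥ m, H x m ≤ H x n

def P (x : ℕ → Fin 3) (m : ℕ) : Prop :=
  safe x m ∧ ((∃ n > m, H x n = H x m) ∨ ∃ N, ∀ n ≥ N, H x n ≠ H x m + 1)

lemma A_of_up {x : ℕ → Fin 3} {m n} (hs : safe x m) (hn : 1 ≤ n) (h : x (m + n) = 1) :
    seg x m (n + 1) ∈ Alang := by
  rw [A_iff]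
  right; right
  constructor
  · rw [R_iff]
    exact ⟨(seg_ok _ _ _).2 fun l _ => hs _ (by omega), seg x m n, by rw [seg_succ, h]⟩
  · intro h
    have := congrArg List.length h
    rw [seg_length] at this
    simp at this
    omega

lemma step_aux {x : ℕ → Fin 3} {m m' : ℕ} (hs : safe x m) (hm : m < m') (hs' : safe x m')
    (hA : seg x m (m' - m) ∈ Alang) : ∃ p > m, seg x m (p - m) ∈ Alang ∧ P x p := by
  by_cases hP : P x m'
  · exact ⟨m', hm, hA, hP⟩
  · have h1 : ∀ n > m', H x n ≠ H x m' := fun n hn h => hP ⟨hs', Or.inl ⟨n, hn, h⟩⟩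
    have h2 : ∀ N, ∃ n ≥ N, H x n = H x m' + 1 := by
      intro N
      by_contra hcon
      push Not at hcon
      exact hP ⟨hs', Or.inr ⟨N, hcon⟩⟩
    have h3 : ∀ n > m', H x m' + 1 ≤ H x n := by
      intro n hn
      have := h1 n hn
      have := hs' n hn.le
      omega
    have e : H x (m' + 1) = H x m' + wt (x m') := rfl
    have h4 := h3 (m' + 1) (by omega)
    have h5 := wt_le (x m')
    have h6 : x m' = 1 := wt_one (by omega)
    refine ⟨m' + 1, by omega, ?_, ?_, Or.inl ?_⟩
    · have := A_of_up (x := x) (m := m) (n := m' - m) hs (by omega)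
        (by rw [show m + (m' - m) = m' by omega]; exact h6)
      rwa [show m' + 1 - m = m' - m + 1 by omega]
    · intro n hn
      have := h3 n (by omega)
      omega
    · obtain ⟨n, hn, h⟩ := h2 (m' + 2)
      exact ⟨n, by omega, by omega⟩

lemma step {x : ℕ → Fin 3} {m : ℕ} (h : P x m) : ∃ p > m, seg x m (p - m) ∈ Alang ∧ P x p := by
  obtain ⟨hs, h⟩ := h
  by_cases h0 : ∃ n > m, H x n = H x m
  · obtain ⟨n, hn, hH⟩ := h0
    have hD : D (seg x m (n - m)) := by
      rw [D_iff, seg_ok]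
      refine ⟨fun l _ => hs _ (by omega), ?_⟩
      have := seg_count x m (n - m)
      rw [show m + (n - m) = n by omega] at this
      omega
    have hl := seg_length x m (n - m)
    have fin : ∀ u v : List (Fin 3), seg x m (n - m) = u ++ v → u ≠ [] → u.count 1 = u.count 2 →
        u ∈ Alang → ∃ p > m, seg x m (p - m) ∈ Alang ∧ P x p := by
      intro u v e hne hc hu
      have hle : u.length ≤ n - m := by rw [← hl, e]; simp
      have e2 : seg x m u.length = u := by
        rw [← seg_take x m (n - m) u.length hle, e]; simp
      have hpos := List.length_pos_of_ne_nil hne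
      refine step_aux hs (m' := m + u.length) (by omega) ?_ ?_
      · intro k hk
        have := seg_count x m u.length
        rw [e2] at this
        have := hs k (by omega)
        omega
      · rw [Nat.add_sub_cancel_left, e2]; exact hu
    generalize hseg : seg x m (n - m) = s at hD
    cases hD with
    | nil => rw [hseg] at hl; simp at hl; omega
    | @zero w _ => exact fin [0] w hseg (by simp) (by simp) ((A_iff _).2 (Or.inl rfl))
    | @br u v hu hv =>
      exact fin (1 :: (u ++ [2])) v (by simp [hseg]) (by simp) (by simp [hu.count])
        ((A_iff _).2 (Or.inr (Or.inl ⟨u, hu, rfl⟩)))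
  · have h' := h.resolve_left h0
    push Not at h0
    classical
    have hmin : ∀ N, ∀ _ : (∀ n ≥ N, H x n ≠ H x m + 1), ∃ M, (∀ n ≥ M, H x n ≠ H x m + 1) ∧
        ∀ k < M, ¬ ∀ n ≥ k, H x n ≠ H x m + 1 :=
      fun N hN => ⟨Nat.find ⟨N, hN⟩, Nat.find_spec (⟨N, hN⟩ : ∃ N, ∀ n ≥ N, H x n ≠ H x m + 1),
        fun k hk => Nat.find_min _ hk⟩
    obtain ⟨N0, hN0⟩ := h'
    obtain ⟨N, hN, hlt⟩ := hmin N0 hN0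
    have e : H x (m + 1) = H x m + wt (x m) := rfl
    have h3 : ∀ n > m, H x m + 1 ≤ H x n := by
      intro n hn
      have := h0 n hn
      have := hs n hn.le
      omega
    have h4 := h3 (m + 1) (by omega)
    have h5 := wt_le (x m)
    have hNm : m + 1 < N := by
      by_contra hcon
      exact hN (m + 1) (by omega) (by omega)
    obtain ⟨M, rfl⟩ : ∃ M, N = M + 1 := ⟨N - 1, by omega⟩
    have h6 : H x M = H x m + 1 := by
      by_contra hcon
      refine hlt M (by omega) fun n hn => ?_
      rcases hn.lt_or_eq with h | h
      · exact hN n (by omega)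
      · rw [← h]; exact hcon
    have e2 : H x (M + 1) = H x M + wt (x M) := rfl
    have h7 := hN (M + 1) le_rfl
    have h8 := h3 (M + 1) (by omega)
    have h9 := wt_le (x M)
    have h10 : x M = 1 := wt_one (by omega)
    refine step_aux hs (m' := M + 1) (by omega) ?_ ?_
    · intro n hn
      have := hN n hn
      have := h3 n (by omega)
      omega
    · have := A_of_up (x := x) (m := m) (n := M - m) hs (by omega)
        (by rw [show m + (M - m) = M by omega]; exact h10)
      rwa [show M + 1 - m = M - m + 1 by omega]

lemma A_ok {s} (h : s ∈ Alang) : ok 0 s := by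
  rw [A_iff] at h
  rcases h with rfl | ⟨u, hu, rfl⟩ | ⟨h, _⟩
  · simp [ok]
  · exact (D.br hu D.nil).ok 0
  · exact h.ok 0

lemma mem_omega {x : ℕ → Fin 3} : x ∈ omegaPower Alang ↔ P x 0 := by
  constructor
  · rintro ⟨f, hf0, hf, hA⟩
    replace hA : ∀ k, seg x (f k) (f (k + 1) - f k) ∈ Alang := hA
    have hseg : ∀ k, ∀ n, f k ≤ n → n ≤ f (k + 1) → H x (f k) ≤ H x n := by
      intro k n h1 h2
      have := (seg_ok _ _ _).1 (A_ok (hA k)) (n - f k) (by omega)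
      rwa [show f k + (n - f k) = n by omega] at this
    have hs : ∀ k, safe x (f k) := by
      intro k
      have hm : ∀ j, H x (f k) ≤ H x (f (k + j)) ∧
          ∀ n, f k ≤ n → n ≤ f (k + j) → H x (f k) ≤ H x n := by
        intro j
        induction j with
        | zero =>
          refine ⟨le_rfl, fun n h1 h2 => ?_⟩
          have : n = f k := le_antisymm h2 h1
          rw [this]
        | succ j ih =>
          have key : ∀ n, f k ≤ n → n ≤ f (k + (j + 1)) → H x (f k) ≤ H x n := by
            intro n h1 h2
            rcases le_total n (f (k + j)) with h | h
            · exact ih.2 n h1 h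
            · exact ih.1.trans (hseg (k + j) n h h2)
          exact ⟨key _ (hf.monotone (by omega)) le_rfl, key⟩
      intro n hn
      refine (hm n).2 n hn ?_
      exact (by omega : n ≤ k + n).trans (hf.le_apply)
    have hs0 := hs 0
    have hs1 := hs 1
    rw [hf0] at hs0
    refine ⟨hs0, ?_⟩
    have hpos : 0 < f 1 := by rw [← hf0]; exact hf (by omega)
    have hA0 := hA 0
    simp only [hf0, zero_add, Nat.sub_zero] at hA0
    have hc := seg_count x 0 (f 1)
    rw [zero_add] at hc
    have H0 : H x 0 = 0 := rfl
    rw [A_iff] at hA0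
    rcases hA0 with h | ⟨u, hu, h⟩ | ⟨h, hne⟩
    · left
      refine ⟨f 1, hpos, ?_⟩
      rw [h] at hc
      simp at hc
      omega
    · left
      refine ⟨f 1, hpos, ?_⟩
      rw [h] at hc
      simp [hu.count] at hc
      omega
    · by_cases h2 : 2 ≤ H x (f 1)
      · right
        refine ⟨f 1, fun n hn => ?_⟩
        have := hs1 n hn
        omega
      · left
        obtain ⟨t, ht⟩ := h.last
        obtain ⟨M, hM⟩ : ∃ M, f 1 = M + 1 := ⟨f 1 - 1, by omega⟩
        rw [hM, seg_succ] at ht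
        have hx := (List.append_inj' ht rfl).2
        simp at hx
        have e : H x (M + 1) = H x M + wt (x M) := rfl
        rw [hx] at e
        simp [wt] at e
        refine ⟨M, ?_, ?_⟩
        · rcases Nat.eq_zero_or_pos M with h0 | h0
          · subst h0
            rw [hM] at hne
            simp [seg, hx] at hne
          · exact h0
        · have := hs0 M (by omega)
          rw [hM] at h2
          omega
  · intro h
    choose! g hg using fun m (h : P x m) => step h
    let f : ℕ → ℕ := fun n => g^[n] 0
    have hP : ∀ n, P x (f n) := by
      intro n
      induction n with
      | zero => exact h
      | succ n ih =>
        change P x (g^[n + 1] 0)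
        rw [Function.iterate_succ_apply']
        exact (hg _ ih).2.2
    have hfs : ∀ n, f (n + 1) = g (f n) := fun n => Function.iterate_succ_apply' g n 0
    refine ⟨f, rfl, strictMono_nat_of_lt_succ fun n => ?_, fun k => ?_⟩
    · rw [hfs]; exact (hg _ (hP n)).1
    · rw [hfs]; exact (hg _ (hP k)).2.1

lemma cont_H (n : ℕ) : Continuous fun x => H x n := by
  induction n with
  | zero => exact continuous_const
  | succ n ih => exact ih.add ((continuous_of_discreteTopology (f := wt)).comp (continuous_apply n))

theorem fSigma : FSigmaSet (omegaPower Alang) := by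
  refine ⟨fun k => {x | ∀ n, 0 ≤ H x n} ∩ ({x | H x (k + 1) = 0} ∪ {x | ∀ n ≥ k, H x n ≠ 1}),
    fun k => ?_, ?_⟩
  · refine IsClosed.inter ?_ (IsClosed.union ?_ ?_)
    · simp only [Set.ofPred_forall]
      exact isClosed_iInter fun n => isClosed_le continuous_const (cont_H n)
    · exact isClosed_eq (cont_H _) continuous_const
    · simp only [Set.ofPred_forall]
      refine isClosed_iInter fun n => isClosed_iInter fun _ => ?_
      exact (isClosed_discrete ({1}ᶜ : Set ℤ)).preimage (cont_H n)
  · ext x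
    simp only [mem_omega, P, safe, Set.mem_iUnion]
    have H0 : H x 0 = 0 := rfl
    simp only [H0]
    constructor
    · rintro ⟨h1, ⟨n, hn, h⟩ | ⟨N, h⟩⟩
      · refine ⟨n - 1, fun n => h1 n (by simp), Or.inl ?_⟩
        have : n - 1 + 1 = n := by omega
        simpa [this] using h
      · exact ⟨N, fun n => h1 n (by simp), Or.inr (by simpa using h)⟩
    · rintro ⟨k, h1, h | h⟩
      · exact ⟨fun n _ => h1 n, Or.inl ⟨k + 1, by omega, h⟩⟩
      · exact ⟨fun n _ => h1 n, Or.inr ⟨k, by simpa using h⟩⟩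

lemma H_congr {x y : ℕ → Fin 3} {k : ℕ} (h : ∀ i < k, x i = y i) : ∀ n ≤ k, H x n = H y n := by
  intro n
  induction n with
  | zero => intro _; rfl
  | succ n ih => intro hn; simp only [H]; rw [ih (by omega), h n (by omega)]

def K : Set (ℕ → Fin 3) := {x | ∀ n, 1 ≤ H x (n + 1)}

lemma dense_of_ext (S : Set K)
    (h : ∀ x ∈ K, ∀ k, ∃ y : K, y ∈ S ∧ ∀ i < k, y.1 i = x i) : Dense S := by
  rintro ⟨x, hx⟩
  choose y hy1 hy2 using h x hx
  refine mem_closure_of_tendsto (f := y) (b := Filter.atTop) ?_ (Filter.Eventually.of_forall hy1)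
  rw [tendsto_subtype_rng, tendsto_pi_nhds]
  intro i
  refine tendsto_const_nhds.congr' ?_
  filter_upwards [Filter.eventually_gt_atTop i] with k hk
  exact (hy2 k i hk).symm

theorem not_gDelta : ¬ GDeltaSet (omegaPower Alang) := by
  rintro ⟨U, hU, hUe⟩
  have hK : IsClosed K := by
    simp only [K, Set.ofPred_forall]
    exact isClosed_iInter fun n => isClosed_le continuous_const (cont_H _)
  have : CompactSpace K := isCompact_iff_compactSpace.1 hK.isCompact
  let S : Set K := {x | x.1 ∈ omegaPower Alang}
  let B : Set K := {x | ∀ N, ∃ n ≥ N, H x.1 n = 1}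
  have hS : IsGδ S := by
    have : S = ⋂ n, (Subtype.val ⁻¹' U n) := by
      ext x
      simp only [S, hUe, Set.mem_iInter, Set.mem_ofPred_eq, Set.mem_preimage]
    rw [this]
    exact IsGδ.iInter_of_isOpen fun n => (hU n).preimage continuous_subtype_val
  have hB : IsGδ B := by
    have : B = ⋂ N : ℕ, ⋃ n ≥ N, {x : K | H x.1 n = 1} := by
      ext x
      simp [B]
    rw [this]
    refine IsGδ.iInter_of_isOpen fun N => isOpen_iUnion fun n => isOpen_iUnion fun _ => ?_
    exact (isOpen_discrete ({1} : Set ℤ)).preimage ((cont_H n).comp continuous_subtype_val)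
  have hSB : ∀ x : K, x ∈ S → x ∈ B → False := by
    intro x h1 h2
    obtain ⟨_, ⟨n, hn, h⟩ | ⟨N, h⟩⟩ := mem_omega.1 h1
    · have := x.2 (n - 1)
      rw [show n - 1 + 1 = n by omega, h] at this
      simp [H] at this
    · obtain ⟨n, hn, h'⟩ := h2 N
      exact h n hn (by simpa [H] using h')
  have dS : Dense S := by
    apply dense_of_ext
    intro x hx k
    let y : ℕ → Fin 3 := fun i => if i < k + 1 then x i else 1
    have hy : ∀ i < k + 1, y i = x i := fun i hi => by simp only [y, if_pos hi]
    have h1 := H_congr hy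
    have h2 : ∀ j, H y (k + 1 + j) = H x (k + 1) + j := by
      intro j
      induction j with
      | zero => simpa using h1 (k + 1) le_rfl
      | succ j ih =>
        rw [← add_assoc, H, ih]
        have : y (k + 1 + j) = 1 := if_neg (by omega)
        rw [this]
        simp [wt]; ring
    have hyK : y ∈ K := by
      intro n
      rcases le_total (n + 1) (k + 1) with h | h
      · rw [h1 _ h]; exact hx n
      · obtain ⟨j, hj⟩ := Nat.exists_eq_add_of_le h
        rw [hj, h2]
        have := hx k
        omega
    refine ⟨⟨y, hyK⟩, mem_omega.2 ⟨?_, Or.inr ⟨k + 2, ?_⟩⟩, fun i hi => hy i (by omega)⟩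
    · intro n _
      cases n with
      | zero => exact le_rfl
      | succ n => exact le_trans (by simp [H]) (hyK n)
    · intro n hn
      obtain ⟨j, hj⟩ := Nat.exists_eq_add_of_le (show k + 1 ≤ n by omega)
      change H y n ≠ H y 0 + 1
      rw [hj, h2, show H y 0 = 0 from rfl]
      have := hx k
      omega
  have dB : Dense B := by
    apply dense_of_ext
    intro x hx k
    let y : ℕ → Fin 3 := fun i => if i < k + 1 then x i else
      if 1 < H x (k + 1) - ((i : ℤ) - ((k + 1 : ℕ) : ℤ)) then 2 else 0
    have hy : ∀ i < k + 1, y i = x i := fun i hi => by simp only [y, if_pos hi]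
    have h1 := H_congr hy
    have hk := hx k
    have h2 : ∀ j : ℕ, H y (k + 1 + j) = max (H x (k + 1) - j) 1 := by
      intro j
      induction j with
      | zero => 
        have := h1 (k + 1) le_rfl
        simp [this, hk]
      | succ j ih =>
        rw [← add_assoc, H, ih]
        have : y (k + 1 + j) = if 1 < H x (k + 1) - (j : ℤ) then 2 else 0 := by
          simp only [y]
          rw [if_neg (by omega)]
          congr 2
          push_cast
          ring
        rw [this]
        split_ifs with h
        · simp only [wt]; norm_num; omega
        · simp only [wt]; norm_num; omega
    have hyK : y ∈ K := by
      intro n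
      rcases le_total (n + 1) (k + 1) with h | h
      · rw [h1 _ h]; exact hx n
      · obtain ⟨j, hj⟩ := Nat.exists_eq_add_of_le h
        rw [hj, h2]
        exact le_max_right _ _
    refine ⟨⟨y, hyK⟩, ?_, fun i hi => hy i (by omega)⟩
    intro N
    refine ⟨k + 1 + (N + (H x (k + 1)).toNat), by omega, ?_⟩
    rw [h2]
    push_cast
    omega
  have hd := Dense.inter_of_Gδ hS hB dS dB
  have hne : Nonempty K := by
    refine ⟨⟨fun _ => 1, ?_⟩⟩
    have : ∀ n, H (fun _ => 1) n = n := by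
      intro n
      induction n with
      | zero => rfl
      | succ n ih => rw [H, ih]; simp [wt]
    intro n
    rw [this]
    push_cast
    omega
  obtain ⟨x, h1, h2⟩ := hd.nonempty
  exact hSB x h1 h2

end AL

/-- The language `A` is context-free, and its ω-power `A^ω` is an `F_σ` subset of `3^ω`
which is not `G_δ`. -/
theorem Alang_contextFree_omegaPower_fSigma_not_gDelta :
    Language.IsContextFree (Alang : Language (Fin 3)) ∧
      FSigmaSet (omegaPower Alang) ∧ ¬ GDeltaSet (omegaPower Alang) := by
  exact ⟨AL.contextFree, AL.fSigma, AL.not_gDelta⟩
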